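/- arXiv:2203.11538 — 5 statements merged into one kernel-verified Lean document; each statement's English description precedes it below -/
import Mathlib

section
/- Let p be an integer and q, r nonnegative integers with p + q + r = 0. Then the function (x,y) ↦ R(x,y)^p x^q y^r is bounded on ℝ² \ {(0,0)}: there exists a constant C such that |R(x,y)^p x^q y^r| ≤ C for all (x,y) ≠ (0,0). -/
/-- If `p + q + r = 0` then `(x,y) ↦ R(x,y)^p x^q y^r` is bounded
on `ℝ² \ {(0,0)}`, where `R(x,y)^p = (a x² + b x y + c y²)^(p/2)`. -/
theorem stmt_1 (a b c : ℝ) (ha : 0 < a) (hc : 0 < c) (hd : 0 < 4 * a * c - b ^ 2)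
    (p : ℤ) (q r : ℕ) (hpqr : p + (q : ℤ) + (r : ℤ) = 0) :
    ∃ C : ℝ, ∀ x y : ℝ, (x, y) ≠ ((0 : ℝ), (0 : ℝ)) →
      |(a * x ^ 2 + b * x * y + c * y ^ 2) ^ ((p : ℝ) / 2) * x ^ q * y ^ r| ≤ C := by
  refine ⟨(√(4 * c / (4 * a * c - b ^ 2))) ^ q * (√(4 * a / (4 * a * c - b ^ 2))) ^ r, ?_⟩
  intro x y hxy
  set D := 4 * a * c - b ^ 2 with hD
  set Q := a * x ^ 2 + b * x * y + c * y ^ 2 with hQ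
  have h1 : D * x ^ 2 ≤ 4 * c * Q := by
    rw [hD, hQ]; nlinarith [sq_nonneg (b * x + 2 * c * y)]
  have h2 : D * y ^ 2 ≤ 4 * a * Q := by
    rw [hD, hQ]; nlinarith [sq_nonneg (b * y + 2 * a * x)]
  have hQpos : 0 < Q := by
    by_cases hx : x = 0
    · have hy : y ≠ 0 := by
        rintro rfl
        exact hxy (by rw [hx])
      have h3 : 0 < D * y ^ 2 := by positivity
      exact pos_of_mul_pos_right (lt_of_lt_of_le h3 h2) (by positivity)
    · have h3 : 0 < D * x ^ 2 := by positivity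
      exact pos_of_mul_pos_right (lt_of_lt_of_le h3 h1) (by positivity)
  have hs : 0 < √Q := Real.sqrt_pos.mpr hQpos
  have hx : |x| ≤ √(4 * c / D) * √Q := by
    rw [← Real.sqrt_mul (by positivity)]
    apply Real.abs_le_sqrt
    rw [div_mul_eq_mul_div, le_div_iff₀ hd]
    linarith
  have hy : |y| ≤ √(4 * a / D) * √Q := by
    rw [← Real.sqrt_mul (by positivity)]
    apply Real.abs_le_sqrt
    rw [div_mul_eq_mul_div, le_div_iff₀ hd]
    linarith
  have hp : (p : ℝ) / 2 = (1 / 2) * (-((q + r : ℕ) : ℝ)) := by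
    have : (p : ℝ) + q + r = 0 := by exact_mod_cast hpqr
    push_cast
    linarith
  have hpow : Q ^ ((p : ℝ) / 2) = (√Q ^ (q + r))⁻¹ := by
    rw [hp, Real.rpow_mul hQpos.le, ← Real.sqrt_eq_rpow, Real.rpow_neg hs.le, Real.rpow_natCast]
  rw [hpow, abs_mul, abs_mul, abs_pow, abs_pow, abs_of_pos (by positivity)]
  calc (√Q ^ (q + r))⁻¹ * |x| ^ q * |y| ^ r
      ≤ (√Q ^ (q + r))⁻¹ * (√(4 * c / D) * √Q) ^ q * (√(4 * a / D) * √Q) ^ r := by gcongr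
    _ = √(4 * c / D) ^ q * √(4 * a / D) ^ r := by
      rw [mul_pow, mul_pow, pow_add]
      field_simp
end

section
/- Let p be an integer, q, r nonnegative integers, and n a nonnegative integer with p + q + r ≥ n + 1. Then the function f : ℝ² → ℝ defined by f(x,y) = R(x,y)^p x^q y^r for (x,y) ≠ (0,0) and f(0,0) = 0 is n times continuously differentiable on ℝ², and every partial derivative of f of order at most n vanishes at the origin. -/
/-- A positively homogeneous function, continuous off the origin, is bounded by a power of the norm. -/
lemma hom_bound {F : Type} [NormedAddCommGroup F] [NormedSpace ℝ F]
    (f : ℝ × ℝ → F) (m : ℕ) (hm : 1 ≤ m)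
    (hom : ∀ t : ℝ, 0 < t → ∀ z, f (t • z) = t ^ m • f z)
    (hs : ContinuousOn f {0}ᶜ) : f 0 = 0 ∧ ∃ C : ℝ, ∀ z, ‖f z‖ ≤ C * ‖z‖ ^ m := by
  have h0 : f 0 = 0 := by
    have h := hom 2 (by norm_num) 0
    rw [smul_zero] at h
    have h2 : ((2 : ℝ) ^ m - 1) • f 0 = 0 := by
      rw [sub_smul, one_smul, ← h, sub_self]
    rcases smul_eq_zero.1 h2 with h3 | h3
    · have : (1 : ℝ) < 2 ^ m := one_lt_pow₀ (by norm_num) (by omega)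
      linarith
    · exact h3
  refine ⟨h0, ?_⟩
  obtain ⟨C, hC⟩ := (isCompact_sphere (0 : ℝ × ℝ) 1).exists_bound_of_continuousOn
    (hs.mono (fun z hz => by
      rintro rfl
      simp at hz))
  refine ⟨C, fun z => ?_⟩
  by_cases hz : z = 0
  · subst hz
    rw [h0]
    simp [show m ≠ 0 by omega]
  · have hz' : 0 < ‖z‖ := norm_pos_iff.2 hz
    have h1 := hom ‖z‖ hz' (‖z‖⁻¹ • z)
    rw [smul_smul, mul_inv_cancel₀ hz'.ne', one_smul] at h1
    rw [h1, norm_smul, norm_pow, norm_norm, mul_comm]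
    gcongr
    apply hC
    rw [mem_sphere_zero_iff_norm, norm_smul, norm_inv, norm_norm, inv_mul_cancel₀ hz'.ne']

lemma hom_main (n : ℕ) : ∀ {F : Type} [NormedAddCommGroup F] [NormedSpace ℝ F]
    (f : ℝ × ℝ → F) (m : ℕ) (_ : n + 1 ≤ m)
    (_ : ∀ t : ℝ, 0 < t → ∀ z, f (t • z) = t ^ m • f z)
    (_ : ∀ N : ℕ, ContDiffOn ℝ N f {0}ᶜ),
    ContDiff ℝ n f ∧ ∀ k ≤ n, iteratedFDeriv ℝ k f 0 = 0 := by
  have hopen : IsOpen ({0}ᶜ : Set (ℝ × ℝ)) := isOpen_compl_singleton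
  induction n with
  | zero =>
    intro F _ _ f m hm hom hs
    obtain ⟨h0, C, hC⟩ := hom_bound f m (by omega) hom (hs 0).continuousOn
    constructor
    · rw [Nat.cast_zero, contDiff_zero, continuous_iff_continuousAt]
      intro z
      by_cases hz : z = 0
      · subst hz
        unfold ContinuousAt
        rw [h0]
        apply squeeze_zero_norm hC
        have : Continuous (fun z : ℝ × ℝ => C * ‖z‖ ^ m) := by fun_prop
        have h := this.tendsto 0
        simpa [show m ≠ 0 by omega] using h
      · exact (hs 0).continuousOn.continuousAt (hopen.mem_nhds hz)
    · intro k hk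
      obtain rfl : k = 0 := by omega
      ext v
      simp [h0]
  | succ n ih =>
    intro F _ _ f m hm hom hs
    obtain ⟨h0, C, hC⟩ := hom_bound f m (by omega) hom (hs 0).continuousOn
    obtain ⟨m, rfl⟩ : ∃ m', m = m' + 1 := ⟨m - 1, by omega⟩
    have hd0 : HasFDerivAt f (0 : ℝ × ℝ →L[ℝ] F) 0 := by
      rw [hasFDerivAt_iff_isLittleO_nhds_zero]
      simp only [zero_add, h0, sub_zero, ContinuousLinearMap.zero_apply]
      have h1 : f =O[nhds 0] (fun z : ℝ × ℝ => ‖z‖ ^ (m + 1)) := by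
        apply Asymptotics.IsBigO.of_bound C
        filter_upwards with z
        simpa using hC z
      refine h1.trans_isLittleO ?_
      exact Asymptotics.isLittleO_norm_pow_id (by omega)
    have hdiff : Differentiable ℝ f := by
      intro z
      by_cases hz : z = 0
      · subst hz
        exact hd0.differentiableAt
      · exact ((hs 1).contDiffAt (hopen.mem_nhds hz)).differentiableAt (by simp)
    have key := ih (fderiv ℝ f) m (by omega) (by
      intro t ht z
      have h1 : fderiv ℝ (fun x => f (t • x)) z = t • fderiv ℝ f (t • z) := by
        rw [fderiv_comp_smul]
      have h2 : (fun x => f (t • x)) = fun x => t ^ (m + 1) • f x := funext (hom t ht)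
      rw [h2, fderiv_fun_const_smul (hdiff z), pow_succ', mul_smul] at h1
      exact (smul_right_injective _ ht.ne' h1).symm) (by
      intro N
      exact (hs (N + 1)).fderiv_of_isOpen hopen (by norm_cast))
    constructor
    · rw [Nat.cast_succ, contDiff_succ_iff_fderiv]
      exact ⟨hdiff, by simp, key.1⟩
    · intro k hk
      cases k with
      | zero =>
        ext v
        simp [h0]
      | succ k =>
        ext v
        rw [iteratedFDeriv_succ_apply_right, key.2 k (by omega)]
        simp

/-- If `p + q + r ≥ n + 1` then the function
`f(x,y) = R(x,y)^p x^q y^r` (for `(x,y) ≠ (0,0)`), `f(0,0) = 0`,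
is `n` times continuously differentiable on `ℝ²` and every derivative of order
at most `n` vanishes at the origin. -/
theorem stmt_4 (a b c : ℝ) (ha : 0 < a) (hc : 0 < c) (hd : 0 < 4 * a * c - b ^ 2)
    (p : ℤ) (q r : ℕ) (n : ℕ) (hpqr : (n : ℤ) + 1 ≤ p + (q : ℤ) + (r : ℤ))
    (f : ℝ × ℝ → ℝ)
    (hf0 : f (0, 0) = 0)
    (hf : ∀ z : ℝ × ℝ, z ≠ (0, 0) →
      f z = (a * z.1 ^ 2 + b * z.1 * z.2 + c * z.2 ^ 2) ^ ((p : ℝ) / 2)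
        * z.1 ^ q * z.2 ^ r) :
    ContDiff ℝ n f ∧ ∀ k ≤ n, iteratedFDeriv ℝ k f (0, 0) = 0 := by
  have hpos : ∀ z : ℝ × ℝ, z ≠ (0, 0) → 0 < a * z.1 ^ 2 + b * z.1 * z.2 + c * z.2 ^ 2 := by
    rintro ⟨x, y⟩ hz
    have h4 : 0 < 4 * a * (a * x ^ 2 + b * x * y + c * y ^ 2) := by
      have e : 4 * a * (a * x ^ 2 + b * x * y + c * y ^ 2)
        = (2 * a * x + b * y) ^ 2 + (4 * a * c - b ^ 2) * y ^ 2 := by ring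
      rw [e]
      by_cases hy : y = 0
      · subst hy
        have hx : x ≠ 0 := by
          rintro rfl
          exact hz rfl
        have : 2 * a * x + b * 0 ≠ 0 := by simp [ha.ne', hx]
        positivity
      · positivity
    exact pos_of_mul_pos_right h4 (by positivity)
  obtain ⟨m, hm⟩ := Int.eq_ofNat_of_zero_le (a := p + q + r) (by omega)
  refine hom_main n f m (by omega) ?_ ?_
  · intro t ht z
    by_cases hz : z = (0, 0)
    · subst hz
      simp [hf0]
    · have htz : t • z ≠ (0, 0) := smul_ne_zero ht.ne' hz
      rw [hf _ htz, hf _ hz]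
      have e : a * (t • z).1 ^ 2 + b * (t • z).1 * (t • z).2 + c * (t • z).2 ^ 2
          = t ^ 2 * (a * z.1 ^ 2 + b * z.1 * z.2 + c * z.2 ^ 2) := by
        simp only [Prod.smul_fst, Prod.smul_snd, smul_eq_mul]
        ring
      have e2 : (t ^ 2) ^ ((p : ℝ) / 2) = t ^ p := by
        rw [← Real.rpow_natCast, ← Real.rpow_mul ht.le, ← Real.rpow_intCast]
        congr 1
        push_cast
        ring
      have e3 : t ^ m = t ^ p * t ^ q * t ^ r := by
        rw [← zpow_natCast t m, ← zpow_natCast t q, ← zpow_natCast t r, ← zpow_add₀ ht.ne',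
          ← zpow_add₀ ht.ne']
        congr 1
        exact hm.symm
      rw [e, Real.mul_rpow (by positivity) (hpos z hz).le, e2, e3]
      simp only [Prod.smul_fst, Prod.smul_snd, smul_eq_mul]
      ring
  · intro N
    have h : ContDiffOn ℝ N (fun z : ℝ × ℝ =>
        (a * z.1 ^ 2 + b * z.1 * z.2 + c * z.2 ^ 2) ^ ((p : ℝ) / 2)
        * z.1 ^ q * z.2 ^ r) {0}ᶜ := by
      refine (ContDiffOn.mul (ContDiffOn.rpow_const_of_ne ?_ ?_) ?_).mul ?_
      · fun_prop
      · intro z hz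
        exact (hpos z hz).ne'
      · fun_prop
      · fun_prop
    exact h.congr (fun z hz => hf z hz)
end

section
/- Let n ≥ 1 be an integer, m₁ ≥ 0 and m₂ ≥ −3 integers, and for each ℓ = 1, …, n let P_ℓ : ℝ² → ℝ be a homogeneous polynomial function of degree 3ℓ + m₂. Suppose there exists ε > 0 such that P₁(z) > 0 for all z with 0 < ‖z‖₂ ≤ ε. Then there exists ε' > 0 such that the function K_n(z) := ∑_{ℓ=1}^{n} R(z)^{−2(ℓ+m₁)+1} P_ℓ(z) satisfies K_n(z) > 0 for every z with 0 < ‖z‖₂ ≤ ε'. -/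
theorem quad_pos_aux (a b c : ℝ) (ha : 0 < a) (hd : 0 < 4 * a * c - b ^ 2)
    (z : ℝ × ℝ) (hz : z ≠ 0) : 0 < a * z.1 ^ 2 + b * z.1 * z.2 + c * z.2 ^ 2 := by
  have key : 4 * a * (a * z.1 ^ 2 + b * z.1 * z.2 + c * z.2 ^ 2)
      = (2 * a * z.1 + b * z.2) ^ 2 + (4 * a * c - b ^ 2) * z.2 ^ 2 := by ring
  have h : 0 < 4 * a * (a * z.1 ^ 2 + b * z.1 * z.2 + c * z.2 ^ 2) := by
    rw [key]
    by_cases h2 : z.2 = 0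
    · have h1 : z.1 ≠ 0 := fun h1 => hz (Prod.ext h1 h2)
      rw [h2]
      have : 0 < (2 * a * z.1 + b * 0) ^ 2 := by
        have : 2 * a * z.1 + b * 0 ≠ 0 := by simp [h1, ha.ne']
        positivity
      simpa using this
    · have := mul_pos hd (pow_pos (abs_pos.mpr h2) 2)
      rw [sq_abs] at this
      positivity
  exact pos_of_mul_pos_right h (by positivity)

theorem circle_compact_aux : IsCompact {u : ℝ × ℝ | u.1 ^ 2 + u.2 ^ 2 = 1} := by
  apply Metric.isCompact_of_isClosed_isBounded
  · exact isClosed_eq (by fun_prop) (by fun_prop)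
  · refine (Metric.isBounded_closedBall (x := (0 : ℝ × ℝ)) (r := 1)).subset ?_
    intro u hu
    simp only [Set.mem_ofPred_eq] at hu
    rw [mem_closedBall_zero_iff, Prod.norm_def, sup_le_iff, Real.norm_eq_abs, Real.norm_eq_abs]
    constructor <;> apply abs_le_one_iff_mul_self_le_one.mpr <;> nlinarith [sq_nonneg u.1, sq_nonneg u.2]

/-- If `P₁` (a homogeneous polynomial of degree `3 + m₂`) is positive
on a punctured disk around the origin, then the truncated kernel
`K_n(z) = ∑_{ℓ=1}^{n} R(z)^(−2(ℓ+m₁)+1) P_ℓ(z)` is positive on a (possibly smaller)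
punctured disk. -/
theorem stmt_7 (a b c : ℝ) (ha : 0 < a) (hc : 0 < c) (hd : 0 < 4 * a * c - b ^ 2)
    (n : ℕ) (hn : 1 ≤ n) (m₁ : ℕ) (m₂ : ℤ) (hm₂ : -3 ≤ m₂)
    (P : ℕ → ℝ × ℝ → ℝ)
    (hhom : ∀ ℓ ∈ Finset.Icc 1 n, ∃ cα : ℕ → ℝ, ∀ z : ℝ × ℝ,
      P ℓ z = ∑ j ∈ Finset.range ((3 * (ℓ : ℤ) + m₂).toNat + 1),
        cα j * z.1 ^ j * z.2 ^ ((3 * (ℓ : ℤ) + m₂).toNat - j))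
    (ε : ℝ) (hε : 0 < ε)
    (hP1 : ∀ z : ℝ × ℝ, z ≠ 0 → Real.sqrt (z.1 ^ 2 + z.2 ^ 2) ≤ ε → 0 < P 1 z) :
    ∃ ε' > (0 : ℝ), ∀ z : ℝ × ℝ, z ≠ 0 → Real.sqrt (z.1 ^ 2 + z.2 ^ 2) ≤ ε' →
      0 < ∑ ℓ ∈ Finset.Icc 1 n,
        (a * z.1 ^ 2 + b * z.1 * z.2 + c * z.2 ^ 2)
            ^ ((-2 * ((ℓ : ℝ) + (m₁ : ℝ)) + 1) / 2) * P ℓ z := by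
  have homog : ∀ ℓ ∈ Finset.Icc 1 n, ∀ (r : ℝ) (u : ℝ × ℝ),
      P ℓ (r • u) = r ^ (3 * (ℓ : ℤ) + m₂).toNat * P ℓ u := by
    intro ℓ hℓ r u
    obtain ⟨cα, h⟩ := hhom ℓ hℓ
    rw [h, h, Finset.mul_sum]
    refine Finset.sum_congr rfl fun j hj => ?_
    have hj' : j ≤ (3 * (ℓ : ℤ) + m₂).toNat := by
      have := Finset.mem_range.mp hj
      omega
    conv_rhs => rw [← Nat.add_sub_of_le hj', pow_add]
    simp only [Prod.smul_fst, Prod.smul_snd, smul_eq_mul, mul_pow, Nat.add_sub_cancel_left]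
    ring
  have cont : ∀ ℓ ∈ Finset.Icc 1 n, Continuous (P ℓ) := by
    intro ℓ hℓ
    obtain ⟨cα, h⟩ := hhom ℓ hℓ
    rw [funext h]
    fun_prop
  have qpos := quad_pos_aux a b c ha hd
  have h1mem : 1 ∈ Finset.Icc 1 n := Finset.mem_Icc.mpr ⟨le_rfl, hn⟩
  have ne0 : ∀ u : ℝ × ℝ, u.1 ^ 2 + u.2 ^ 2 = 1 → u ≠ 0 := by
    rintro u hu rfl
    norm_num at hu
  have P1pos : ∀ u : ℝ × ℝ, u.1 ^ 2 + u.2 ^ 2 = 1 → 0 < P 1 u := by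
    intro u hu
    have h := hP1 (ε • u) (smul_ne_zero hε.ne' (ne0 u hu)) (by
      simp only [Prod.smul_fst, Prod.smul_snd, smul_eq_mul]
      rw [show (ε * u.1) ^ 2 + (ε * u.2) ^ 2 = ε ^ 2 * (u.1 ^ 2 + u.2 ^ 2) by ring, hu, mul_one,
        Real.sqrt_sq hε.le])
    rw [homog 1 h1mem] at h
    exact pos_of_mul_pos_right h (by positivity)
  have ev : ∀ᶠ r : ℝ in nhds 0, ∀ u ∈ {u : ℝ × ℝ | u.1 ^ 2 + u.2 ^ 2 = 1},
      0 < ∑ ℓ ∈ Finset.Icc 1 n, r ^ (ℓ - 1) *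
        ((a * u.1 ^ 2 + b * u.1 * u.2 + c * u.2 ^ 2)
            ^ ((-2 * ((ℓ : ℝ) + (m₁ : ℝ)) + 1) / 2) * P ℓ u) := by
    refine circle_compact_aux.eventually_forall_of_forall_eventually fun u hu => ?_
    have hc : ContinuousAt (fun x : ℝ × (ℝ × ℝ) => ∑ ℓ ∈ Finset.Icc 1 n, x.1 ^ (ℓ - 1) *
        ((a * x.2.1 ^ 2 + b * x.2.1 * x.2.2 + c * x.2.2 ^ 2)
            ^ ((-2 * ((ℓ : ℝ) + (m₁ : ℝ)) + 1) / 2) * P ℓ x.2)) (0, u) := by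
      refine tendsto_finsetSum _ fun ℓ hℓ => ?_
      have h1 : ContinuousAt (fun x : ℝ × (ℝ × ℝ) =>
          (a * x.2.1 ^ 2 + b * x.2.1 * x.2.2 + c * x.2.2 ^ 2)
            ^ ((-2 * ((ℓ : ℝ) + (m₁ : ℝ)) + 1) / 2)) (0, u) :=
        ContinuousAt.rpow_const (by fun_prop) (Or.inl (qpos u (ne0 u hu)).ne')
      have h2 : ContinuousAt (fun x : ℝ × (ℝ × ℝ) => P ℓ x.2) (0, u) :=
        ((cont ℓ hℓ).comp continuous_snd).continuousAt
      have h3 : ContinuousAt (fun x : ℝ × (ℝ × ℝ) => x.1 ^ (ℓ - 1)) (0, u) := by fun_prop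
      exact h3.mul (h1.mul h2)
    refine hc.eventually (lt_mem_nhds (a := 0) ?_)
    beta_reduce
    rw [Finset.sum_eq_single_of_mem 1 h1mem]
    · simp only [Nat.sub_self, pow_zero, one_mul]
      exact mul_pos (Real.rpow_pos_of_pos (qpos u (ne0 u hu)) _) (P1pos u hu)
    · intro ℓ hℓ hne
      have := (Finset.mem_Icc.mp hℓ).1
      rw [zero_pow (by omega), zero_mul]
  obtain ⟨δ, hδ, hball⟩ := Metric.eventually_nhds_iff.mp ev
  refine ⟨δ / 2, half_pos hδ, fun z hz hzr => ?_⟩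
  set r := Real.sqrt (z.1 ^ 2 + z.2 ^ 2) with hr
  have hsq : 0 < z.1 ^ 2 + z.2 ^ 2 := by
    have := quad_pos_aux 1 0 1 one_pos (by norm_num) z hz
    simpa using this
  have hr0 : 0 < r := Real.sqrt_pos.mpr hsq
  have hr2 : r ^ 2 = z.1 ^ 2 + z.2 ^ 2 := Real.sq_sqrt hsq.le
  clear_value r
  clear hr
  obtain ⟨u, rfl⟩ : ∃ u : ℝ × ℝ, z = r • u := ⟨r⁻¹ • z, by rw [smul_inv_smul₀ hr0.ne']⟩
  simp only [Prod.smul_fst, Prod.smul_snd, smul_eq_mul] at hr2 ⊢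
  have hu : u.1 ^ 2 + u.2 ^ 2 = 1 := by
    have : r ^ 2 * (u.1 ^ 2 + u.2 ^ 2) = r ^ 2 * 1 := by linarith
    exact mul_left_cancel₀ (by positivity) this
  have hG := hball (y := r) (by rw [Real.dist_eq, sub_zero, abs_of_pos hr0]; linarith) u hu
  have hq := qpos u (ne0 u hu)
  have hfac := mul_pos (Real.rpow_pos_of_pos hr0 ((m₂ : ℝ) - 2 * m₁ + 2)) hG
  rw [Finset.mul_sum] at hfac
  refine hfac.trans_eq (Finset.sum_congr rfl fun ℓ hℓ => ?_)
  have hℓ1 := (Finset.mem_Icc.mp hℓ).1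
  rw [homog ℓ hℓ, show a * (r * u.1) ^ 2 + b * (r * u.1) * (r * u.2) + c * (r * u.2) ^ 2
    = r ^ 2 * (a * u.1 ^ 2 + b * u.1 * u.2 + c * u.2 ^ 2) by ring,
    Real.mul_rpow (by positivity) hq.le]
  have e1 : (r ^ 2) ^ ((-2 * ((ℓ : ℝ) + (m₁ : ℝ)) + 1) / 2)
      = r ^ (-2 * ((ℓ : ℝ) + (m₁ : ℝ)) + 1) := by
    rw [← Real.rpow_natCast r 2, ← Real.rpow_mul hr0.le]
    congr 1
    push_cast
    ring
  have e2 : (((3 * (ℓ : ℤ) + m₂).toNat : ℕ) : ℝ) = 3 * (ℓ : ℝ) + m₂ := by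
    have : (((3 * (ℓ : ℤ) + m₂).toNat : ℕ) : ℤ) = 3 * (ℓ : ℤ) + m₂ := Int.toNat_of_nonneg (by omega)
    exact_mod_cast this
  have e3 : r ^ ((m₂ : ℝ) - 2 * m₁ + 2) * r ^ (ℓ - 1)
      = r ^ (-2 * ((ℓ : ℝ) + (m₁ : ℝ)) + 1) * r ^ (3 * (ℓ : ℤ) + m₂).toNat := by
    rw [← Real.rpow_natCast r (ℓ - 1), ← Real.rpow_natCast r (3 * (ℓ : ℤ) + m₂).toNat,
      ← Real.rpow_add hr0, ← Real.rpow_add hr0, e2, Nat.cast_sub hℓ1]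
    congr 1
    push_cast
    ring
  rw [e1]
  linear_combination ((a * u.1 ^ 2 + b * u.1 * u.2 + c * u.2 ^ 2)
    ^ ((-2 * ((ℓ : ℝ) + (m₁ : ℝ)) + 1) / 2) * P ℓ u) * e3
end

section
/- Let p ≤ −3 be an odd integer and fix y ≠ 0. Define D_ℓ := −a(2ℓ + 6) and E_ℓ := −2/((4ac − b²)(ℓ + 2)) for integers ℓ, and define F(x,y) := ∑_{ℓ ∈ {p+2, p+4, …, −1}} ( ∏_{ℓ₂ ∈ {p, p+2, …, ℓ−4}} D_{ℓ₂} ) · ( ∏_{ℓ₂ ∈ {p, p+2, …, ℓ−2}} E_{ℓ₂} ) · R(x,y)^{ℓ} · (2ax + by) · y^{p−ℓ}, where empty products equal 1. Then for every x ∈ ℝ the function x ↦ F(x,y) is differentiable with ∂F/∂x(x,y) = R(x,y)^{p}; that is, F is an antiderivative in x of R^{p}. -/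
lemma stmt_13_aux (a b c : ℝ) (ha : 0 < a) (hd : 0 < 4 * a * c - b ^ 2)
    (s : ℝ) (hs : ∀ j : ℕ, s + 2 * (j : ℝ) + 2 ≠ 0)
    (y : ℝ) (hy : y ≠ 0) (x : ℝ) (N : ℕ) :
    HasDerivAt
      (fun x' : ℝ =>
        ∑ k ∈ Finset.Icc 1 N,
          (∏ j ∈ Finset.range (k - 1), (-a * (2 * (s + 2 * (j : ℝ)) + 6))) *
          (∏ j ∈ Finset.range k, (-2 / ((4 * a * c - b ^ 2) * (s + 2 * (j : ℝ) + 2)))) *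
          (a * x' ^ 2 + b * x' * y + c * y ^ 2) ^ ((s + 2 * (k : ℝ)) / 2) *
          (2 * a * x' + b * y) * y ^ (-(2 * (k : ℤ))))
      ((a * x ^ 2 + b * x * y + c * y ^ 2) ^ (s / 2) -
        (∏ j ∈ Finset.range N, (-a * (2 * (s + 2 * (j : ℝ)) + 6))) *
          (∏ j ∈ Finset.range N, (-2 / ((4 * a * c - b ^ 2) * (s + 2 * (j : ℝ) + 2)))) *
          (a * x ^ 2 + b * x * y + c * y ^ 2) ^ ((s + 2 * (N : ℝ)) / 2) *
          y ^ (-(2 * (N : ℤ)))) x := by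
  have hQ : 0 < a * x ^ 2 + b * x * y + c * y ^ 2 := by
    have h1 : 0 < (4 * a * c - b ^ 2) * y ^ 2 := by positivity
    have h2 : 0 < 4 * a * (a * x ^ 2 + b * x * y + c * y ^ 2) := by
      nlinarith [sq_nonneg (2 * a * x + b * y)]
    exact pos_of_mul_pos_right h2 (by positivity)
  induction N with
  | zero => simpa using hasDerivAt_const x (0 : ℝ)
  | succ n ih =>
    have hq : HasDerivAt (fun x' : ℝ => a * x' ^ 2 + b * x' * y + c * y ^ 2)
        (2 * a * x + b * y) x := by
      have := ((((hasDerivAt_id x).pow 2).const_mul a).add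
        (((hasDerivAt_id x).const_mul b).mul_const y)).add_const (c * y ^ 2)
      refine HasDerivAt.congr_deriv this ?_
      simp only [id]; push_cast; ring
    have hL : HasDerivAt (fun x' : ℝ => 2 * a * x' + b * y) (2 * a) x := by
      simpa using ((hasDerivAt_id x).const_mul (2 * a)).add_const (b * y)
    have ht := (((hq.rpow_const (p := (s + 2 * ((n + 1 : ℕ) : ℝ)) / 2) (Or.inl hQ.ne')).const_mul
      ((∏ j ∈ Finset.range (n + 1 - 1), (-a * (2 * (s + 2 * (j : ℝ)) + 6))) *
          (∏ j ∈ Finset.range (n + 1),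
            (-2 / ((4 * a * c - b ^ 2) * (s + 2 * (j : ℝ) + 2)))))).mul hL).mul_const
      (y ^ (-(2 * ((n + 1 : ℕ) : ℤ))))
    simp_rw [Finset.sum_Icc_succ_top (Nat.le_add_left 1 n)]
    refine (ih.add ht).congr_deriv ?_
    simp only [Nat.add_sub_cancel, Finset.prod_range_succ]
    have e1 : (s + 2 * ((n + 1 : ℕ) : ℝ)) / 2 - 1 = (s + 2 * (n : ℝ)) / 2 := by
      push_cast; ring
    have e2 : (s + 2 * ((n + 1 : ℕ) : ℝ)) / 2 = (s + 2 * (n : ℝ)) / 2 + 1 := by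
      push_cast; ring
    have e3 : y ^ (-(2 * (n : ℤ))) = y ^ (-(2 * ((n + 1 : ℕ) : ℤ))) * y ^ 2 := by
      rw [← zpow_natCast y 2, ← zpow_add₀ hy]; congr 1; push_cast; ring
    rw [e1, e2, e3, Real.rpow_add hQ, Real.rpow_one]
    have hn := hs n
    have hd' := hd.ne'
    generalize (a * x ^ 2 + b * x * y + c * y ^ 2) ^ ((s + 2 * (n : ℝ)) / 2) = W
    generalize y ^ (-(2 * ((n + 1 : ℕ) : ℤ))) = Y
    generalize ∏ j ∈ Finset.range n, (-a * (2 * (s + 2 * (j : ℝ)) + 6)) = A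
    generalize ∏ j ∈ Finset.range n, (-2 / ((4 * a * c - b ^ 2) * (s + 2 * (j : ℝ) + 2))) = B
    generalize hE : -2 / ((4 * a * c - b ^ 2) * (s + 2 * (n : ℝ) + 2)) = E
    have hE' : E * ((4 * a * c - b ^ 2) * (s + 2 * (n : ℝ) + 2)) = -2 := by
      rw [← hE]; field_simp
    linear_combination (-(A * B * W * Y * y ^ 2) / 2) * hE'

/-- For an odd integer `p ≤ −3` and fixed `y ≠ 0`, the function
`F(x,y) = ∑_{ℓ ∈ {p+2, p+4, …, −1}} (∏_{ℓ₂ ∈ {p,…,ℓ−4}} D_{ℓ₂})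
(∏_{ℓ₂ ∈ {p,…,ℓ−2}} E_{ℓ₂}) R(x,y)^ℓ (2ax + by) y^(p−ℓ)`, with
`D_ℓ = −a(2ℓ+6)` and `E_ℓ = −2/((4ac−b²)(ℓ+2))`, is an antiderivative in `x`
of `R^p`.  The index `ℓ = p + 2k` runs over `k = 1, …, (−p−1)/2`, so that the
index sets `{p,…,ℓ−4}` and `{p,…,ℓ−2}` are `{p+2j : j < k−1}` and
`{p+2j : j < k}` respectively, and `y^(p−ℓ) = y^(−2k)`. -/
theorem stmt_13 (a b c : ℝ) (ha : 0 < a) (hc : 0 < c) (hd : 0 < 4 * a * c - b ^ 2)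
    (p : ℤ) (hp : p ≤ -3) (hodd : Odd p)
    (y : ℝ) (hy : y ≠ 0) (x : ℝ) :
    HasDerivAt
      (fun x' : ℝ =>
        ∑ k ∈ Finset.Icc 1 ((-p - 1) / 2).toNat,
          (∏ j ∈ Finset.range (k - 1), (-a * (2 * ((p : ℝ) + 2 * (j : ℝ)) + 6))) *
          (∏ j ∈ Finset.range k, (-2 / ((4 * a * c - b ^ 2) * ((p : ℝ) + 2 * (j : ℝ) + 2)))) *
          (a * x' ^ 2 + b * x' * y + c * y ^ 2) ^ (((p : ℝ) + 2 * (k : ℝ)) / 2) *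
          (2 * a * x' + b * y) * y ^ (-(2 * (k : ℤ))))
      ((a * x ^ 2 + b * x * y + c * y ^ 2) ^ ((p : ℝ) / 2)) x := by
  obtain ⟨q, rfl⟩ := hodd
  have hs : ∀ j : ℕ, ((2 * q + 1 : ℤ) : ℝ) + 2 * (j : ℝ) + 2 ≠ 0 := by
    intro j h
    have h' : (2 * q + 1 : ℤ) + 2 * (j : ℤ) + 2 = 0 := by exact_mod_cast h
    omega
  refine (stmt_13_aux a b c ha hd _ hs y hy x _).congr_deriv ?_
  obtain ⟨n, hn⟩ : ∃ n : ℕ, q = -(n : ℤ) - 2 := ⟨(-q - 2).toNat, by omega⟩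
  have hN : ((-(2 * q + 1) - 1) / 2).toNat = n + 1 := by omega
  have hz : ∏ j ∈ Finset.range ((-(2 * q + 1) - 1) / 2).toNat,
      (-a * (2 * (((2 * q + 1 : ℤ) : ℝ) + 2 * (j : ℝ)) + 6)) = 0 := by
    refine Finset.prod_eq_zero (i := n) (by rw [hN]; simp) ?_
    rw [hn]; push_cast; ring
  rw [hz]; simp
end

section
/- Define bivariate polynomial functions P_q(x,y) and real constants C_q for integers q ≥ −1 by the recurrences P_{−1} = 0, P_0 = 1/a, P_q = (1/(a(q+1)))·( x^{q} − (b(2q+1)/2)·y·P_{q−1} − c·q·y²·P_{q−2} ) for q ≥ 1, and C_{−1} = 1, C_0 = −b/(2a), C_q = (1/(a(q+1)))·( −(b(2q+1)/2)·C_{q−1} − c·q·C_{q−2} ) for q ≥ 1. Then for every integer q ≥ 0 and every fixed y ≠ 0, the function x ↦ R(x,y)·P_{q−1}(x,y) + C_{q−1}·y^{q}·(1/√a)·log(2√a·R(x,y) + 2ax + by) is differentiable in x with derivative equal to R(x,y)^{−1}·x^{q}; that is, it is an antiderivative in x of R^{−1}x^{q}. -/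
/-- Let `P_q(x,y)` and `C_q` (for integers `q ≥ −1`) satisfy the
recurrences `P_{−1} = 0`, `P_0 = 1/a`,
`P_q = (1/(a(q+1)))·(x^q − (b(2q+1)/2)·y·P_{q−1} − c·q·y²·P_{q−2})` for `q ≥ 1`,
and `C_{−1} = 1`, `C_0 = −b/(2a)`,
`C_q = (1/(a(q+1)))·(−(b(2q+1)/2)·C_{q−1} − c·q·C_{q−2})` for `q ≥ 1`.
Then for every natural `q` and every `y ≠ 0`, the function
`x ↦ R·P_{q−1} + C_{q−1}·y^q·(1/√a)·log(2√a·R + 2ax + by)` is an antiderivative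
in `x` of `R^(−1) x^q`. -/
theorem stmt_14 (a b c : ℝ) (ha : 0 < a) (hc : 0 < c) (hd : 0 < 4 * a * c - b ^ 2)
    (P : ℤ → ℝ → ℝ → ℝ) (C : ℤ → ℝ)
    (hPm1 : ∀ x y : ℝ, P (-1) x y = 0)
    (hP0 : ∀ x y : ℝ, P 0 x y = 1 / a)
    (hPrec : ∀ q : ℤ, 1 ≤ q → ∀ x y : ℝ,
      P q x y = (1 / (a * ((q : ℝ) + 1))) *
        (x ^ q - b * (2 * (q : ℝ) + 1) / 2 * y * P (q - 1) x y
          - c * (q : ℝ) * y ^ 2 * P (q - 2) x y))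
    (hCm1 : C (-1) = 1)
    (hC0 : C 0 = -b / (2 * a))
    (hCrec : ∀ q : ℤ, 1 ≤ q →
      C q = (1 / (a * ((q : ℝ) + 1))) *
        (-(b * (2 * (q : ℝ) + 1) / 2) * C (q - 1) - c * (q : ℝ) * C (q - 2))) :
    ∀ (q : ℕ) (y : ℝ), y ≠ 0 → ∀ x : ℝ,
      HasDerivAt
        (fun x' : ℝ =>
          Real.sqrt (a * x' ^ 2 + b * x' * y + c * y ^ 2) * P ((q : ℤ) - 1) x' y
            + C ((q : ℤ) - 1) * y ^ q * ((1 / Real.sqrt a) *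
                Real.log (2 * Real.sqrt a *
                    Real.sqrt (a * x' ^ 2 + b * x' * y + c * y ^ 2)
                  + 2 * a * x' + b * y)))
        ((a * x ^ 2 + b * x * y + c * y ^ 2) ^ (-(1 : ℝ) / 2) * x ^ q) x := by
  intro q y hy
  have hQ : ∀ x : ℝ, 0 < a * x ^ 2 + b * x * y + c * y ^ 2 := by
    intro x
    have hy2 : 0 < y ^ 2 := by positivity
    have h1 : 0 < (4 * a * c - b ^ 2) * y ^ 2 := mul_pos hd hy2
    have h2 : 0 < 4 * a * (a * x ^ 2 + b * x * y + c * y ^ 2) := by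
      nlinarith [sq_nonneg (2 * a * x + b * y)]
    exact pos_of_mul_pos_right h2 (by positivity)
  have hsa : 0 < Real.sqrt a := Real.sqrt_pos.2 ha
  have hsa2 : Real.sqrt a ^ 2 = a := Real.sq_sqrt ha.le
  have hR : ∀ x : ℝ, HasDerivAt
      (fun x' : ℝ => Real.sqrt (a * x' ^ 2 + b * x' * y + c * y ^ 2))
      ((2 * a * x + b * y) / (2 * Real.sqrt (a * x ^ 2 + b * x * y + c * y ^ 2))) x := by
    intro x
    have h : HasDerivAt (fun x' : ℝ => a * x' ^ 2 + b * x' * y + c * y ^ 2)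
        (2 * a * x + b * y) x := by
      have h0 := (((hasDerivAt_pow 2 x).const_mul a).add
        (((hasDerivAt_id x).const_mul b).mul_const y)).add_const (c * y ^ 2)
      refine h0.congr_deriv ?_
      simp
      ring
    exact h.sqrt (hQ x).ne'
  have hRpos : ∀ x : ℝ, 0 < Real.sqrt (a * x ^ 2 + b * x * y + c * y ^ 2) :=
    fun x => Real.sqrt_pos.2 (hQ x)
  have hRsq : ∀ x : ℝ, Real.sqrt (a * x ^ 2 + b * x * y + c * y ^ 2) ^ 2
      = a * x ^ 2 + b * x * y + c * y ^ 2 := fun x => Real.sq_sqrt (hQ x).le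
  have hLpos : ∀ x : ℝ, 0 < 2 * Real.sqrt a *
      Real.sqrt (a * x ^ 2 + b * x * y + c * y ^ 2) + 2 * a * x + b * y := by
    intro x
    have hy2 : 0 < y ^ 2 := by positivity
    have h1 : 0 < (4 * a * c - b ^ 2) * y ^ 2 := mul_pos hd hy2
    have h3 : |2 * a * x + b * y| < 2 * Real.sqrt a *
      Real.sqrt (a * x ^ 2 + b * x * y + c * y ^ 2) := by
      apply abs_lt_of_sq_lt_sq _ (by positivity)
      rw [mul_pow, mul_pow, hRsq, hsa2]
      nlinarith
    have := (abs_lt.1 h3).1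
    linarith
  have hL : ∀ x : ℝ, HasDerivAt
      (fun x' : ℝ => (1 / Real.sqrt a) * Real.log (2 * Real.sqrt a *
          Real.sqrt (a * x' ^ 2 + b * x' * y + c * y ^ 2) + 2 * a * x' + b * y))
      (1 / Real.sqrt (a * x ^ 2 + b * x * y + c * y ^ 2)) x := by
    intro x
    have h0 := ((((hR x).const_mul (2 * Real.sqrt a)).add
      ((hasDerivAt_id x).const_mul (2 * a))).add_const (b * y))
    have h1 := (h0.log (hLpos x).ne').const_mul (1 / Real.sqrt a)
    refine h1.congr_deriv ?_
    have e1 := hRpos x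
    have e2 := hLpos x
    simp only [Pi.add_apply, id]
    generalize Real.sqrt (a * x ^ 2 + b * x * y + c * y ^ 2) = r at *
    generalize Real.sqrt a = s at *
    subst hsa2
    have e4 : 2 * s * ((2 * s ^ 2 * x + b * y) / (2 * r)) + 2 * s ^ 2 * 1
        = s * (2 * s * r + 2 * s ^ 2 * x + b * y) / r := by
      field_simp
      ring
    rw [e4]
    generalize 2 * s * r + 2 * s ^ 2 * x + b * y = l at *
    field_simp
  have key : ∀ n : ℕ, ∀ x : ℝ, HasDerivAt
        (fun x' : ℝ =>
          Real.sqrt (a * x' ^ 2 + b * x' * y + c * y ^ 2) * P ((n : ℤ) - 1) x' y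
            + C ((n : ℤ) - 1) * y ^ n * ((1 / Real.sqrt a) *
                Real.log (2 * Real.sqrt a *
                    Real.sqrt (a * x' ^ 2 + b * x' * y + c * y ^ 2)
                  + 2 * a * x' + b * y)))
        (x ^ n / Real.sqrt (a * x ^ 2 + b * x * y + c * y ^ 2)) x := by
    intro n
    induction n using Nat.twoStepInduction with
    | zero =>
      intro x
      simpa [hPm1, hCm1] using hL x
    | one =>
      intro x
      have h := ((hR x).mul_const (1 / a)).add ((hL x).const_mul (-b / (2 * a) * y))
      have e1 := hRpos x
      have h' := h.congr_deriv (g' := x ^ 1 /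
        Real.sqrt (a * x ^ 2 + b * x * y + c * y ^ 2)) (by field_simp; ring)
      refine h'.congr_of_eventuallyEq (Filter.Eventually.of_forall fun z => ?_)
      simp [hP0, hC0]
    | more n ih0 ih1 =>
      intro x
      have h := ((((hR x).mul (hasDerivAt_pow (n + 1) x)).sub
        ((ih1 x).const_mul (b * (2 * ((n : ℝ) + 1) + 1) / 2 * y))).sub
        ((ih0 x).const_mul (c * ((n : ℝ) + 1) * y ^ 2))).const_mul
          (1 / (a * ((n : ℝ) + 1 + 1)))
      have e1 := hRpos x
      have e2 := hRsq x
      have h' := h.congr_deriv (g' := x ^ (n + 2) /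
        Real.sqrt (a * x ^ 2 + b * x * y + c * y ^ 2)) (by
          have e3 : (n : ℝ) + 1 + 1 ≠ 0 := by positivity
          simp only [Nat.add_sub_cancel]
          push_cast
          generalize Real.sqrt (a * x ^ 2 + b * x * y + c * y ^ 2) = r at *
          field_simp
          rw [e2]
          ring)
      refine h'.congr_of_eventuallyEq (Filter.Eventually.of_forall fun z => ?_)
      have i0 : ((n + 2 : ℕ) : ℤ) - 1 = (n : ℤ) + 1 := by push_cast; ring
      have i1 : (n : ℤ) + 1 - 2 = (n : ℤ) - 1 := by ring
      have i2 : (n : ℤ) + 1 - 1 = (n : ℤ) := by ring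
      have i3 : ((n + 1 : ℕ) : ℤ) - 1 = (n : ℤ) := by push_cast; ring
      have i4 : z ^ ((n : ℤ) + 1) = z ^ (n + 1) := by exact_mod_cast zpow_natCast z (n + 1)
      simp only [Pi.sub_apply, Pi.mul_apply]
      rw [i0, i3, hPrec ((n : ℤ) + 1) (by omega), hCrec ((n : ℤ) + 1) (by omega), i1, i2, i4]
      push_cast
      ring
  intro x
  refine (key q x).congr_deriv ?_
  rw [neg_div, Real.rpow_neg (hQ x).le, ← Real.sqrt_eq_rpow]
  ring
end
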